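/- Let d ≥ 2 be an even integer, r ∈ F_q^*, and m, m' ∈ F_q^d. Then Σ_{t ∈ F_q} Ŝ_t(m)·Ŝ_{rt}(m') equals q^{−1}·δ_0(m)·δ_0(m') + q^{−d} − q^{−d−1} if ||m|| = r·||m'||, and equals −q^{−d−1} if ||m|| ≠ r·||m'||. Here δ_0(m) = 1 if m is the zero vector and 0 otherwise. -/

import Mathlib

open Finset

def nrm {F : Type} [Field F] {d : ℕ} (x : Fin d → F) : F := ∑ i, x i ^ 2

noncomputable def ft {F : Type} [Field F] [Fintype F] (d : ℕ) (χ : AddChar F ℂ)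
    (f : (Fin d → F) → ℂ) (m : Fin d → F) : ℂ :=
  (Fintype.card F : ℂ) ^ (-(d : ℤ)) * ∑ x : Fin d → F, χ (-(∑ i, x i * m i)) * f x

noncomputable def sphereFT {F : Type} [Field F] [Fintype F] [DecidableEq F] (d : ℕ)
    (χ : AddChar F ℂ) (t : F) (m : Fin d → F) : ℂ :=
  ft d χ (fun x => if nrm x = t then 1 else 0) m

noncomputable def eta (F : Type) [Field F] [Fintype F] [DecidableEq F] (s : F) : ℂ :=
  ((quadraticChar F s : ℤ) : ℂ)

noncomputable def gSum (F : Type) [Field F] [Fintype F] [DecidableEq F] (χ : AddChar F ℂ) : ℂ :=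
  ∑ s ∈ Finset.univ.filter (fun s : F => s ≠ 0), eta F s * χ s

def nu {F : Type} [Field F] [Fintype F] [DecidableEq F] {d : ℕ}
    (E : Finset (Fin d → F)) (t : F) : ℕ :=
  ((E ×ˢ E).filter (fun p => nrm (p.1 - p.2) = t)).card

def distSet {F : Type} [Field F] {d : ℕ} (E : Finset (Fin d → F)) : Set F :=
  {t | ∃ x ∈ E, ∃ y ∈ E, nrm (x - y) = t}

def quotSet {F : Type} [Field F] {d : ℕ} (E : Finset (Fin d → F)) : Set F :=
  {r | ∃ a ∈ distSet E, ∃ b ∈ distSet E, b ≠ 0 ∧ r = a / b}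

def sphereCard (F : Type) [Field F] [Fintype F] [DecidableEq F] (d : ℕ) (t : F) : ℕ :=
  (Finset.univ.filter (fun x : Fin d → F => nrm x = t)).card

section QuadraticExponentialSums

variable {F : Type} [Field F]

lemma map_sum_eq_prod {ι : Type*} (χ : AddChar F ℂ) (s : Finset ι) (f : ι → F) :
    χ (∑ i ∈ s, f i) = ∏ i ∈ s, χ (f i) :=
  map_prod χ.toMonoidHom (fun i => Multiplicative.ofAdd (f i)) s

variable [Fintype F]

lemma ringChar_ne_two_of_odd_card (hq : Odd (Fintype.card F)) : ringChar F ≠ 2 := fun h => by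
  rw [Nat.odd_iff, FiniteField.even_card_of_char_two h] at hq
  exact zero_ne_one hq

lemma sum_quadratic_eq (hF : ringChar F ≠ 2) (χ : AddChar F ℂ) {s : F} (hs : s ≠ 0) (c : F) :
    ∑ u : F, χ (s * u ^ 2 - u * c) = χ (-(c ^ 2 / (4 * s))) * ∑ u : F, χ (s * u ^ 2) := by
  have h2 : (2 : F) ≠ 0 := Ring.two_ne_zero hF
  have h4 : (4 : F) ≠ 0 := by
    rw [show (4 : F) = 2 * 2 by norm_num]; exact mul_ne_zero h2 h2
  rw [← Equiv.sum_comp (Equiv.addRight (c / (2 * s))), Finset.mul_sum]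
  refine Finset.sum_congr rfl fun u _ => ?_
  rw [← AddChar.map_add_eq_mul]
  congr 1
  simp only [Equiv.coe_addRight]
  field_simp
  ring

lemma sum_pi_quadratic_eq (hF : ringChar F ≠ 2) {d : ℕ} (χ : AddChar F ℂ) {s : F} (hs : s ≠ 0)
    (m : Fin d → F) :
    ∑ x : Fin d → F, χ (s * nrm x - ∑ i, x i * m i)
      = χ (-(nrm m / (4 * s))) * (∑ u : F, χ (s * u ^ 2)) ^ d := by
  have h (x : Fin d → F) :
      χ (s * nrm x - ∑ i, x i * m i) = ∏ i, χ (s * x i ^ 2 - x i * m i) := by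
    rw [← map_sum_eq_prod, nrm, Finset.mul_sum, Finset.sum_sub_distrib]
  simp only [h]
  rw [← Fintype.piFinset_univ,
    ← Finset.prod_univ_sum (fun _ => Finset.univ) (fun i u => χ (s * u ^ 2 - u * m i))]
  simp only [sum_quadratic_eq hF χ hs, Finset.prod_mul_distrib, ← map_sum_eq_prod,
    Finset.prod_const, Finset.card_univ, Fintype.card_fin, Finset.sum_neg_distrib, nrm,
    Finset.sum_div]

variable [DecidableEq F]

lemma sum_comp_sq (hF : ringChar F ≠ 2) (f : F → ℂ) :
    ∑ u : F, f (u ^ 2) = ∑ a : F, (1 + ((quadraticChar F a : ℤ) : ℂ)) * f a := by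
  rw [← Finset.sum_fiberwise' Finset.univ (fun u : F => u ^ 2) f]
  refine Finset.sum_congr rfl fun a _ => ?_
  rw [Finset.sum_const, nsmul_eq_mul]
  congr 1
  have h := quadraticChar_card_sqrts hF a
  have h' : ({x : F | x ^ 2 = a}.toFinset) = Finset.univ.filter fun u : F => u ^ 2 = a := by
    ext; simp
  rw [h'] at h
  rw [add_comm]
  exact_mod_cast h

lemma sum_addChar_sq_sq (hF : ringChar F ≠ 2) {ψ : AddChar F ℂ} (hψ : ψ ≠ 1) :
    (∑ u : F, ψ (u ^ 2)) ^ 2 = ((quadraticChar F (-1) : ℤ) : ℂ) * Fintype.card F := by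
  set η := (quadraticChar F).ringHomComp (Int.castRingHom ℂ)
  have hηq : η.IsQuadratic := (quadraticChar_isQuadratic F).comp _
  have hη1 : η ≠ 1 :=
    (MulChar.ringHomComp_ne_one_iff (RingHom.injective_int _)).mpr (quadraticChar_ne_one hF)
  have h : ∑ u : F, ψ (u ^ 2) = gaussSum η ψ := by
    rw [sum_comp_sq hF]
    simp only [add_mul, one_mul, Finset.sum_add_distrib, AddChar.sum_eq_zero_of_ne_one hψ,
      zero_add]
    rfl
  rw [h, gaussSum_sq hη1 hηq (AddChar.IsPrimitive.of_ne_one hψ)]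
  rfl

lemma sum_pi_linear_eq {d : ℕ} {χ : AddChar F ℂ} (hχ : χ ≠ 1) (m : Fin d → F) :
    ∑ x : Fin d → F, χ (-∑ i, x i * m i)
      = (Fintype.card F : ℂ) ^ d * if m = 0 then 1 else 0 := by
  have h (x : Fin d → F) : χ (-∑ i, x i * m i) = ∏ i, χ (x i * -m i) := by
    rw [← map_sum_eq_prod, ← Finset.sum_neg_distrib]
    simp only [mul_neg]
  simp only [h]
  rw [← Fintype.piFinset_univ,
    ← Finset.prod_univ_sum (fun _ => Finset.univ) (fun i u => χ (u * -m i))]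
  simp only [AddChar.sum_mulShift _ (AddChar.IsPrimitive.of_ne_one hχ), neg_eq_zero]
  split_ifs with hm
  · simp [hm]
  · obtain ⟨i, hi⟩ := Function.ne_iff.mp hm
    rw [mul_zero]
    exact Finset.prod_eq_zero (Finset.mem_univ i) (by simpa using hi)

lemma sphereFT_eq_sum {d : ℕ} {χ : AddChar F ℂ} (hχ : χ ≠ 1) (t : F) (m : Fin d → F) :
    sphereFT d χ t m = (Fintype.card F : ℂ) ^ (-(d : ℤ)) * (Fintype.card F : ℂ)⁻¹ *
      ∑ s : F, χ (-(t * s)) * ∑ x : Fin d → F, χ (s * nrm x - ∑ i, x i * m i) := by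
  have hq : (Fintype.card F : ℂ) ≠ 0 := Nat.cast_ne_zero.mpr Fintype.card_ne_zero
  rw [sphereFT, ft, mul_assoc]
  congr 1
  simp only [Finset.mul_sum]
  rw [Finset.sum_comm]
  refine Finset.sum_congr rfl fun x _ => ?_
  have h (s : F) : (Fintype.card F : ℂ)⁻¹ * (χ (-(t * s)) * χ (s * nrm x - ∑ i, x i * m i))
      = (Fintype.card F : ℂ)⁻¹ * χ (-∑ i, x i * m i) * χ (s * (nrm x - t)) := by
    rw [mul_assoc, ← AddChar.map_add_eq_mul, ← AddChar.map_add_eq_mul]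
    congr 2
    ring
  simp only [h]
  rw [← Finset.mul_sum, AddChar.sum_mulShift _ (AddChar.IsPrimitive.of_ne_one hχ)]
  simp only [sub_eq_zero]
  split_ifs
  · field_simp
  · simp

lemma sum_sphereFT_mul {d : ℕ} {χ : AddChar F ℂ} (hχ : χ ≠ 1) (r : F) (m m' : Fin d → F) :
    ∑ t : F, sphereFT d χ t m * sphereFT d χ (r * t) m'
      = ((Fintype.card F : ℂ) ^ (-(d : ℤ))) ^ 2 * (Fintype.card F : ℂ)⁻¹ *
        ∑ s : F, (∑ x : Fin d → F, χ (-(r * s) * nrm x - ∑ i, x i * m i)) *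
          ∑ x : Fin d → F, χ (s * nrm x - ∑ i, x i * m' i) := by
  have hq : (Fintype.card F : ℂ) ≠ 0 := Nat.cast_ne_zero.mpr Fintype.card_ne_zero
  simp only [sphereFT_eq_sum hχ]
  set P : F → ℂ := fun s => ∑ x : Fin d → F, χ (s * nrm x - ∑ i, x i * m i)
  set P' : F → ℂ := fun s => ∑ x : Fin d → F, χ (s * nrm x - ∑ i, x i * m' i)
  set A := (Fintype.card F : ℂ) ^ (-(d : ℤ))
  have key : ∑ t : F, (∑ s, χ (-(t * s)) * P s) * ∑ s, χ (-(r * t * s)) * P' s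
      = Fintype.card F * ∑ s, P (-(r * s)) * P' s := by
    simp only [Finset.sum_mul_sum]
    rw [Finset.sum_comm' (t' := Finset.univ) (s' := fun _ => Finset.univ) (by simp)]
    have h (a : F) : ∑ t : F, ∑ b, χ (-(t * a)) * P a * (χ (-(r * t * b)) * P' b)
        = ∑ b, if a = -(r * b) then Fintype.card F * (P a * P' b) else 0 := by
      rw [Finset.sum_comm]
      refine Finset.sum_congr rfl fun b _ => ?_
      have h' (t : F) : χ (-(t * a)) * P a * (χ (-(r * t * b)) * P' b)
          = P a * P' b * χ (t * (-(a + r * b))) := by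
        rw [show t * (-(a + r * b)) = -(t * a) + -(r * t * b) by ring, AddChar.map_add_eq_mul]
        ring
      simp only [h']
      rw [← Finset.mul_sum, AddChar.sum_mulShift _ (AddChar.IsPrimitive.of_ne_one hχ)]
      simp only [neg_eq_zero, ← eq_neg_iff_add_eq_zero]
      split_ifs
      · ring
      · simp
    simp only [h]
    rw [Finset.sum_comm, Finset.mul_sum]
    simp
  calc _ = A * (Fintype.card F : ℂ)⁻¹ * (A * (Fintype.card F : ℂ)⁻¹) *
        ∑ t : F, (∑ s, χ (-(t * s)) * P s) * ∑ s, χ (-(r * t * s)) * P' s := by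
        rw [Finset.mul_sum]
        exact Finset.sum_congr rfl fun t _ => by ring
    _ = _ := by
        rw [key, ← mul_assoc]
        congr 1
        field_simp

lemma sum_sq_pow_mul_sum_sq_pow (hF : ringChar F ≠ 2) {χ : AddChar F ℂ} (hχ : χ ≠ 1) {d : ℕ}
    (hd : Even d) {a b : F} (ha : a ≠ 0) (hb : b ≠ 0) :
    (∑ u : F, χ (a * u ^ 2)) ^ d * (∑ u : F, χ (b * u ^ 2)) ^ d = (Fintype.card F : ℂ) ^ d := by
  have h {s : F} (hs : s ≠ 0) : (∑ u : F, χ (s * u ^ 2)) ^ 2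
      = ((quadraticChar F (-1) : ℤ) : ℂ) * Fintype.card F := by
    simpa only [AddChar.mulShift_apply] using
      sum_addChar_sq_sq hF (AddChar.IsPrimitive.of_ne_one hχ hs)
  have hη : ((quadraticChar F (-1) : ℤ) : ℂ) ^ 2 = 1 := by
    exact_mod_cast quadraticChar_sq_one (neg_ne_zero.mpr (one_ne_zero (α := F)))
  obtain ⟨k, rfl⟩ := hd
  rw [← two_mul, pow_mul, pow_mul, h ha, h hb, ← mul_pow, mul_mul_mul_comm, ← sq, hη, one_mul,
    ← sq, ← pow_mul]

lemma sum_ne_zero_addChar_inv_mul {χ : AddChar F ℂ} (hχ : χ ≠ 1) (c : F) :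
    ∑ s ∈ Finset.univ.erase (0 : F), χ (s⁻¹ * c) =
      (if c = 0 then (Fintype.card F : ℂ) else 0) - 1 := by
  have h := AddChar.sum_mulShift c (AddChar.IsPrimitive.of_ne_one hχ)
  rw [← Equiv.sum_comp (Equiv.inv F), ← Finset.add_sum_erase _ _ (Finset.mem_univ (0 : F))] at h
  simp only [Equiv.inv_apply, inv_zero, zero_mul, AddChar.map_zero_eq_one] at h
  push_cast at h
  exact eq_sub_of_add_eq' h

end QuadraticExponentialSums

theorem orth_sum_even (F : Type) [Field F] [Fintype F] [DecidableEq F]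
    (hq : Odd (Fintype.card F)) (d : ℕ) (hd : 2 ≤ d) (hde : Even d)
    (χ : AddChar F ℂ) (hχ : χ ≠ 1) (r : F) (hr : r ≠ 0) (m m' : Fin d → F) :
    ∑ t : F, sphereFT d χ t m * sphereFT d χ (r * t) m'
      = if nrm m = r * nrm m' then
          (Fintype.card F : ℂ)⁻¹ * (if m = 0 then 1 else 0) * (if m' = 0 then 1 else 0)
            + (Fintype.card F : ℂ) ^ (-(d : ℤ)) - (Fintype.card F : ℂ) ^ (-(d : ℤ) - 1)
        else
          -(Fintype.card F : ℂ) ^ (-(d : ℤ) - 1) := by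
  have hF := ringChar_ne_two_of_odd_card hq
  have hq0 : (Fintype.card F : ℂ) ≠ 0 := Nat.cast_ne_zero.mpr Fintype.card_ne_zero
  have h2 : (2 : F) ≠ 0 := Ring.two_ne_zero hF
  have h4 : (4 : F) ≠ 0 := by
    rw [show (4 : F) = 2 * 2 by norm_num]; exact mul_ne_zero h2 h2
  have hterm : ∀ s ∈ Finset.univ.erase (0 : F),
      (∑ x : Fin d → F, χ (-(r * s) * nrm x - ∑ i, x i * m i)) *
          ∑ x : Fin d → F, χ (s * nrm x - ∑ i, x i * m' i)
        = (Fintype.card F : ℂ) ^ d * χ (s⁻¹ * ((nrm m - r * nrm m') / (4 * r))) := by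
    intro s hs
    have hs0 : s ≠ 0 := Finset.ne_of_mem_erase hs
    have hrs : -(r * s) ≠ 0 := neg_ne_zero.mpr (mul_ne_zero hr hs0)
    rw [sum_pi_quadratic_eq hF χ hrs, sum_pi_quadratic_eq hF χ hs0, mul_mul_mul_comm,
      sum_sq_pow_mul_sum_sq_pow hF hχ hde hrs hs0, ← AddChar.map_add_eq_mul, mul_comm]
    congr 2
    field_simp
    ring
  have hc : (nrm m - r * nrm m') / (4 * r) = 0 ↔ nrm m = r * nrm m' := by
    rw [div_eq_zero_iff, or_iff_left (mul_ne_zero h4 hr), sub_eq_zero]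
  rw [sum_sphereFT_mul hχ, ← Finset.add_sum_erase _ _ (Finset.mem_univ (0 : F)),
    Finset.sum_congr rfl hterm, ← Finset.mul_sum, sum_ne_zero_addChar_inv_mul hχ]
  simp only [mul_zero, neg_zero, zero_mul, zero_sub, sum_pi_linear_eq hχ, hc]
  rw [zpow_sub_one₀ hq0, zpow_neg, zpow_natCast]
  by_cases h : nrm m = r * nrm m'
  · simp only [if_pos h]
    field_simp
    ring
  · simp only [if_neg h]
    have hm : ¬(m = 0 ∧ m' = 0) := by
      rintro ⟨rfl, rfl⟩
      exact h (by simp [nrm])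
    have hδ : (if m = 0 then (1 : ℂ) else 0) * (if m' = 0 then 1 else 0) = 0 := by
      split_ifs <;> simp_all
    rw [mul_mul_mul_comm, hδ]
    field_simp
    ring
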